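/- Let X be a measurable space, Y a type, and μ_s, μ_u, μ_h probability measures on X with labeling functions f_s, f_u, f_h : X → Y. Then for any functions h, h* : X → Y (all relevant disagreement sets measurable), one has the risk decomposition inequality ε_{μ_u}(h, f_u) ≤ ε_{μ_s}(h, f_s) + |ε_{μ_u}(h, h*) − ε_{μ_s}(h, h*)| + ε_{μ_s}(h*, f_s) + ε_{μ_h}(h*, f_h) + |ε_{μ_h}(h*, f_h) − ε_{μ_u}(h*, f_u)|. -/

import Mathlib

open MeasureTheory

/-- The risk of hypothesis `h` against labeling function `f` under measure `μ`. -/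
noncomputable def risk {X Y : Type*} [MeasurableSpace X] (μ : Measure X) (h f : X → Y) : ℝ :=
  (μ {x | h x ≠ f x}).toReal

theorem risk_comm {X Y : Type*} [MeasurableSpace X] (μ : Measure X) (h f : X → Y) :
    risk μ h f = risk μ f h := by
  simp only [risk, ne_comm]

theorem risk_triangle {X Y : Type*} [MeasurableSpace X] (μ : Measure X) [IsFiniteMeasure μ]
    (h g f : X → Y) : risk μ h f ≤ risk μ h g + risk μ g f := by
  have hsub : {x | h x ≠ f x} ⊆ {x | h x ≠ g x} ∪ {x | g x ≠ f x} := by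
    intro x hx
    by_contra hc
    simp only [Set.mem_union, Set.mem_ofPred_eq, ne_eq, not_or, not_not] at hc
    exact hx (hc.1.trans hc.2)
  exact (measureReal_mono hsub).trans (measureReal_union_le _ _)

theorem risk_decomposition
    {X Y : Type*} [MeasurableSpace X]
    (μs μu μh : Measure X)
    [IsProbabilityMeasure μs] [IsProbabilityMeasure μu] [IsProbabilityMeasure μh]
    (fs fu fh : X → Y)
    (h hstar : X → Y)
    (hm1 : MeasurableSet {x | h x ≠ fs x})
    (hm2 : MeasurableSet {x | h x ≠ fu x})
    (hm3 : MeasurableSet {x | h x ≠ hstar x})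
    (hm4 : MeasurableSet {x | hstar x ≠ fs x})
    (hm5 : MeasurableSet {x | hstar x ≠ fu x})
    (hm6 : MeasurableSet {x | hstar x ≠ fh x}) :
    risk μu h fu ≤
      risk μs h fs + |risk μu h hstar - risk μs h hstar|
        + risk μs hstar fs + risk μh hstar fh
        + |risk μh hstar fh - risk μu hstar fu| := by
  have hu := risk_triangle μu h hstar fu
  have hs := risk_triangle μs h fs hstar
  rw [risk_comm μs fs hstar] at hs
  have hdiff := le_abs_self (risk μu h hstar - risk μs h hstar)
  have hlabel := neg_abs_le (risk μh hstar fh - risk μu hstar fu)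
  linarith
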